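/- arXiv:0909.4341 — 6 statements merged into one kernel-verified Lean document; each statement's English description precedes it below -/
import Mathlib

section
/- Let m+2 ≤ k ≤ N, set c = S[k−1], and suppose the old suffix S[k..N] is lexicographically larger than exactly i of the new suffixes, i.e. i = #{ℓ ∈ [1,m] : S[ℓ..N] ≺ S[k..N]}. Then the old suffix S[k−1..N] is lexicographically larger than exactly j of the new suffixes, i.e. j = #{ℓ ∈ [1,m] : S[ℓ..N] ≺ S[k−1..N]}, where j = C[c] + Rank(c,i) if c ≠ S[m], and j = C[c] + Rank(c,i) + gt[k] if c = S[m]. -/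
open Finset

/-- A downward closed subset of `[1, m]` is an initial segment. -/
theorem Finset.eq_Icc_one_card_of_downward_closed {m : ℕ} {A : Finset ℕ} (hA : A ⊆ Icc 1 m)
    (hdown : ∀ a b, 1 ≤ a → a < b → b ∈ A → a ∈ A) : A = Icc 1 A.card := by
  ext j
  constructor
  · intro hj
    have hsub : Icc 1 j ⊆ A := fun a ha => by
      rw [mem_Icc] at ha
      rcases ha.2.eq_or_lt with rfl | h
      · exact hj
      · exact hdown a j ha.1 h hj
    have hcard := card_le_card hsub
    rw [Nat.card_Icc] at hcard
    exact mem_Icc.2 ⟨(mem_Icc.1 (hA hj)).1, by omega⟩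
  · intro hj
    rw [mem_Icc] at hj
    by_contra hjA
    have hsub : A ⊆ Icc 1 (j - 1) := fun a ha => by
      have ha1 := (mem_Icc.1 (hA ha)).1
      rw [mem_Icc]
      refine ⟨ha1, ?_⟩
      by_contra h
      rcases (show j ≤ a by omega).eq_or_lt with rfl | h
      · exact hjA ha
      · exact hjA (hdown j a hj.1 h ha)
    have hcard := card_le_card hsub
    rw [Nat.card_Icc] at hcard
    omega

theorem List.lex_drop_iff {α : Type*} [LinearOrder α] [Inhabited α] (S : List α) {a b : ℕ}
    (ha : a < S.length) (hb : b < S.length) :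
    List.Lex (· < ·) (S.drop a) (S.drop b) ↔
      S[a]! < S[b]! ∨ S[a]! = S[b]! ∧
        List.Lex (· < ·) (S.drop (a + 1)) (S.drop (b + 1)) := by
  rw [List.drop_eq_getElem_cons ha, List.drop_eq_getElem_cons hb, getElem!_pos S a ha,
    getElem!_pos S b hb]
  exact List.cons_lt_cons_iff

/-- Setting: `S` is a string of length `N` over a linearly ordered alphabet whose last
character occurs nowhere else; `1 ≤ m < N`.  Suffixes starting in `[1,m]` are *new*,
those starting in `[m+1,N]` are *old*.  `sa_int` enumerates the new suffixes in
increasing lexicographic order, `bwt_int` is the corresponding BWT-like array (with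
`none` playing the role of the extra symbol `#`), `C c` counts the new suffixes whose
first character is `< c`, `Rank c i` counts occurrences of `c` in `bwt_int[1..i]`, and
`gt k` records whether the old suffix `S[k..N]` is larger than `S[m+1..N]`.

Claim: for `m+2 ≤ k ≤ N` with `c = S[k-1]`, if the old suffix `S[k..N]` is larger than
exactly `i` new suffixes, then `S[k-1..N]` is larger than exactly
`C[c] + Rank(c,i)` new suffixes if `c ≠ S[m]`, and exactly
`C[c] + Rank(c,i) + gt[k]` new suffixes if `c = S[m]`.
(1-based positions `p` correspond to 0-based indices `p-1`.) -/
theorem stmt0 {α : Type*} [LinearOrder α] [Inhabited α]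
    (S : List α) (N m : ℕ) (hN : S.length = N)
    (hlast : ∀ k, 1 ≤ k → k < N → S[k-1]! ≠ S[N-1]!)
    (hm1 : 1 ≤ m) (hmN : m < N)
    (sa_int : ℕ → ℕ)
    (hsa_mem : ∀ j ∈ Icc 1 m, sa_int j ∈ Icc 1 m)
    (hsa_inj : ∀ j₁ ∈ Icc 1 m, ∀ j₂ ∈ Icc 1 m, sa_int j₁ = sa_int j₂ → j₁ = j₂)
    (hsa_surj : ∀ ℓ ∈ Icc 1 m, ∃ j ∈ Icc 1 m, sa_int j = ℓ)
    (hsa_sorted : ∀ j₁ j₂, 1 ≤ j₁ → j₁ < j₂ → j₂ ≤ m →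
      List.Lex (· < ·) (S.drop (sa_int j₁ - 1)) (S.drop (sa_int j₂ - 1)))
    (bwt_int : ℕ → Option α)
    (hbwt : ∀ j ∈ Icc 1 m,
      bwt_int j = if 1 < sa_int j then some (S[sa_int j - 2]!) else none)
    (C : α → ℕ)
    (hC : ∀ c, C c = ((Icc 1 m).filter (fun ℓ => S[ℓ-1]! < c)).card)
    (Rank : α → ℕ → ℕ)
    (hRank : ∀ c i, Rank c i = ((Icc 1 i).filter (fun j => bwt_int j = some c)).card)
    (gt : ℕ → ℕ)
    (hgt : ∀ k ∈ Icc (m+1) N,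
      gt k = if List.Lex (· < ·) (S.drop m) (S.drop (k-1)) then 1 else 0)
    (k : ℕ) (hk1 : m + 2 ≤ k) (hk2 : k ≤ N)
    (c : α) (hc : c = S[k-2]!)
    (i : ℕ)
    (hi : i = ((Icc 1 m).filter
      (fun ℓ => List.Lex (· < ·) (S.drop (ℓ-1)) (S.drop (k-1)))).card) :
    ((Icc 1 m).filter
      (fun ℓ => List.Lex (· < ·) (S.drop (ℓ-1)) (S.drop (k-2)))).card =
      if c = S[m-1]! then C c + Rank c i + gt k else C c + Rank c i := by
  subst hN
  have hset : (Icc 1 m).filter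
      (fun j => List.Lex (· < ·) (S.drop (sa_int j - 1)) (S.drop (k - 1))) = Icc 1 i := by
    have hcard : ((Icc 1 m).filter
        (fun j => List.Lex (· < ·) (S.drop (sa_int j - 1)) (S.drop (k - 1)))).card = i := by
      rw [hi]
      refine card_bij (fun j _ => sa_int j) ?_ ?_ ?_
      · intro j hj
        rw [mem_filter] at hj ⊢
        exact ⟨hsa_mem j hj.1, hj.2⟩
      · intro j₁ h₁ j₂ h₂ h
        exact hsa_inj _ (mem_filter.1 h₁).1 _ (mem_filter.1 h₂).1 h
      · intro l hl
        rw [mem_filter] at hl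
        obtain ⟨j, hj, rfl⟩ := hsa_surj l hl.1
        exact ⟨j, mem_filter.2 ⟨hj, hl.2⟩, rfl⟩
    rw [← hcard]
    refine Finset.eq_Icc_one_card_of_downward_closed (filter_subset _ _) ?_
    intro a b ha hab hb
    rw [mem_filter, mem_Icc] at hb ⊢
    have hlt : S.drop (sa_int a - 1) < S.drop (sa_int b - 1) :=
      hsa_sorted a b ha hab hb.1.2
    have hlt' : S.drop (sa_int b - 1) < S.drop (k - 1) := hb.2
    exact ⟨⟨ha, by omega⟩, lt_trans hlt hlt'⟩
  have hrank : Rank c i = ((Icc 1 (m - 1)).filter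
      (fun l => S[l-1]! = c ∧ List.Lex (· < ·) (S.drop l) (S.drop (k - 1)))).card := by
    rw [hRank, ← hset]
    refine card_bij (fun j _ => sa_int j - 1) ?_ ?_ ?_
    · intro j hj
      simp only [mem_filter] at hj ⊢
      obtain ⟨⟨hj, hlex⟩, hb⟩ := hj
      rw [hbwt j hj] at hb
      have hmem := mem_Icc.1 (hsa_mem j hj)
      split_ifs at hb with h
      exact ⟨mem_Icc.2 ⟨by omega, by omega⟩, Option.some.inj hb, hlex⟩
    · intro j₁ h₁ j₂ h₂ h
      simp only [mem_filter] at h₁ h₂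
      have hmem₁ := mem_Icc.1 (hsa_mem _ h₁.1.1)
      have hmem₂ := mem_Icc.1 (hsa_mem _ h₂.1.1)
      exact hsa_inj _ h₁.1.1 _ h₂.1.1 (by omega)
    · intro l hl
      simp only [mem_filter, mem_Icc] at hl
      obtain ⟨⟨hl1, hl2⟩, hlc, hlex⟩ := hl
      obtain ⟨j, hj, hjl⟩ := hsa_surj (l + 1) (mem_Icc.2 ⟨by omega, by omega⟩)
      refine ⟨j, ?_, by omega⟩
      simp only [mem_filter]
      refine ⟨⟨hj, ?_⟩, ?_⟩
      · rw [hjl]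
        exact hlex
      · rw [hbwt j hj, hjl, if_pos (by omega), show l + 1 - 2 = l - 1 by omega, hlc]
  have hsplit : ((Icc 1 m).filter
      (fun l => List.Lex (· < ·) (S.drop (l-1)) (S.drop (k-2)))).card =
      C c + ((Icc 1 m).filter
        (fun l => S[l-1]! = c ∧ List.Lex (· < ·) (S.drop l) (S.drop (k - 1)))).card := by
    rw [hC, ← card_union_of_disjoint, ← filter_or]
    · congr 1
      refine filter_congr fun l hl => ?_
      rw [mem_Icc] at hl
      rw [List.lex_drop_iff S (by omega) (by omega), ← hc, show l - 1 + 1 = l by omega,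
        show k - 2 + 1 = k - 1 by omega]
    · exact disjoint_filter.2 fun l _ h h' => h.ne h'.1
  have hIcc : Icc 1 m = insert m (Icc 1 (m - 1)) := by
    ext l
    simp only [mem_insert, mem_Icc]
    omega
  have hnot : m ∉ Icc 1 (m - 1) := by
    rw [mem_Icc]
    omega
  rw [hsplit, hrank, hIcc, filter_insert, hgt k (mem_Icc.2 ⟨by omega, hk2⟩)]
  by_cases hcm : c = S[m-1]!
  · by_cases hlex : List.Lex (· < ·) (S.drop m) (S.drop (k - 1))
    · rw [if_pos ⟨hcm.symm, hlex⟩, if_pos hcm, if_pos hlex,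
        card_insert_of_notMem fun h => hnot (mem_filter.1 h).1]
      omega
    · rw [if_neg fun h => hlex h.2, if_pos hcm, if_neg hlex]
      omega
  · rw [if_neg fun h => hcm h.1.symm, if_neg hcm]
end

section
/- Let k ∈ [m+1,N] be an old position and let q = #{k' ∈ [m+1,N] : S[k'..N] ⪯ S[k..N]} be the rank of S[k..N] among the old suffixes (so q ≥ 1, counting the suffix itself). Then the number of new suffixes lexicographically smaller than S[k..N] equals the largest t ∈ [0,m] such that gap[0] + gap[1] + ⋯ + gap[t−1] < q (where the empty sum for t = 0 is 0). Consequently, the rank of S[k..N] among all N suffixes of S equals q + t. -/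
open Finset

/-- In a strictly increasing sequence `g 1 < ⋯ < g m`, an entry lies below `x` iff its index is
at most the number of entries below `x`. -/
theorem lt_iff_le_card_filter_lt {β : Type*} [LinearOrder β] {m : ℕ} {g : ℕ → β}
    (hg : ∀ i j, 1 ≤ i → i < j → j ≤ m → g i < g j) (x : β) {j : ℕ} (hj : 1 ≤ j) (hjm : j ≤ m) :
    g j < x ↔ j ≤ #{i ∈ Icc 1 m | g i < x} := by
  constructor
  · intro h
    have hsub : Icc 1 j ⊆ {i ∈ Icc 1 m | g i < x} := by
      intro i hi
      rw [mem_Icc] at hi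
      rw [mem_filter, mem_Icc]
      refine ⟨⟨hi.1, hi.2.trans hjm⟩, ?_⟩
      rcases hi.2.eq_or_lt with rfl | hlt
      · exact h
      · exact (hg i j hi.1 hlt hjm).trans h
    simpa using card_le_card hsub
  · intro h
    by_contra hx
    have hsub : ({i ∈ Icc 1 m | g i < x} : Finset ℕ) ⊆ Icc 1 (j - 1) := by
      intro i hi
      rw [mem_filter, mem_Icc] at hi
      rw [mem_Icc]
      refine ⟨hi.1.1, ?_⟩
      by_contra hij
      rcases (show j ≤ i by omega).eq_or_lt with rfl | hlt
      · exact hx hi.2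
      · exact hx ((hg j i hj hlt hi.1.2).trans hi.2)
    have hcard := card_le_card hsub
    rw [Nat.card_Icc] at hcard
    omega

/-- The number of elements of `A` below `g n` is the sum of the numbers of elements in the first
`n` gaps of the strictly increasing sequence `g`. -/
theorem sum_card_gaps_eq_card_filter_lt {ι β : Type*} [LinearOrder β] {m : ℕ} {g : ℕ → β}
    (hg : ∀ i j, 1 ≤ i → i < j → j ≤ m → g i < g j) (A : Finset ι) (f : ι → β)
    (hne : ∀ a ∈ A, ∀ j, 1 ≤ j → j ≤ m → f a ≠ g j) (gap : ℕ → ℕ)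
    (hgap : ∀ s ≤ m, gap s = #{a ∈ A | (1 ≤ s → g s < f a) ∧ (s < m → f a < g (s + 1))})
    (n : ℕ) (hn : n ≤ m) :
    ∑ s ∈ range n, gap s = #{a ∈ A | 1 ≤ n ∧ f a < g n} := by
  classical
  induction n with
  | zero => simp
  | succ n ih =>
    rw [sum_range_succ, ih (by omega), hgap n (by omega), ← card_union_of_disjoint]
    · congr 1
      ext a
      simp only [mem_union, mem_filter]
      constructor
      · rintro (⟨ha, h1, h2⟩ | ⟨ha, -, h2⟩)
        · exact ⟨ha, by omega, h2.trans (hg n (n + 1) h1 (by omega) hn)⟩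
        · exact ⟨ha, by omega, h2 (by omega)⟩
      · rintro ⟨ha, -, h⟩
        by_cases hlt : 1 ≤ n ∧ f a < g n
        · exact Or.inl ⟨ha, hlt⟩
        · refine Or.inr ⟨ha, fun h1 => ?_, fun _ => h⟩
          exact lt_of_le_of_ne (not_lt.1 fun h2 => hlt ⟨h1, h2⟩) (hne a ha n h1 (by omega)).symm
    · rw [disjoint_filter]
      rintro a - ⟨h1, h2⟩ ⟨h3, -⟩
      exact lt_asymm h2 (h3 h1)

/-- Distinct positions of a list start distinct suffixes. -/
theorem List.injOn_drop_sub_one {α : Type*} (S : List α) :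
    Set.InjOn (fun p => S.drop (p - 1)) (Set.Icc 1 S.length) := by
  intro a ha b hb h
  have hlen := congrArg List.length h
  simp only [List.length_drop] at hlen
  rw [Set.mem_Icc] at ha hb
  omega

/-- Setting: `S` is a string of length `N` over a linearly ordered alphabet whose last
character occurs nowhere else; `1 ≤ m < N`; suffixes starting in `[1,m]` are *new*,
those starting in `[m+1,N]` are *old*; `sa_int` enumerates the new suffixes in
increasing lexicographic order; for `0 ≤ t ≤ m`, `gap t` is the number of old suffixes
lying lexicographically strictly between the `t`-th and the `(t+1)`-th smallest new
suffix (with the conventions for `t = 0` and `t = m`).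

Claim: for an old position `k ∈ [m+1,N]` with
`q = #{k' ∈ [m+1,N] : S[k'..N] ⪯ S[k..N]}`, the number `t` of new suffixes
lexicographically smaller than `S[k..N]` is the largest `t ∈ [0,m]` such that
`gap[0] + ⋯ + gap[t-1] < q`; and the rank of `S[k..N]` among all `N` suffixes
equals `q + t`.  (1-based positions `p` correspond to 0-based indices `p-1`.) -/
theorem stmt3 {α : Type*} [LinearOrder α] [Inhabited α]
    (S : List α) (N m : ℕ) (hN : S.length = N)
    (hlast : ∀ k, 1 ≤ k → k < N → S[k-1]! ≠ S[N-1]!)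
    (hm1 : 1 ≤ m) (hmN : m < N)
    (sa_int : ℕ → ℕ)
    (hsa_mem : ∀ j ∈ Icc 1 m, sa_int j ∈ Icc 1 m)
    (hsa_inj : ∀ j₁ ∈ Icc 1 m, ∀ j₂ ∈ Icc 1 m, sa_int j₁ = sa_int j₂ → j₁ = j₂)
    (hsa_surj : ∀ ℓ ∈ Icc 1 m, ∃ j ∈ Icc 1 m, sa_int j = ℓ)
    (hsa_sorted : ∀ j₁ j₂, 1 ≤ j₁ → j₁ < j₂ → j₂ ≤ m →
      List.Lex (· < ·) (S.drop (sa_int j₁ - 1)) (S.drop (sa_int j₂ - 1)))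
    (gap : ℕ → ℕ)
    (hgap : ∀ t ≤ m, gap t = ((Icc (m+1) N).filter (fun k =>
        (1 ≤ t → List.Lex (· < ·) (S.drop (sa_int t - 1)) (S.drop (k-1))) ∧
        (t < m → List.Lex (· < ·) (S.drop (k-1)) (S.drop (sa_int (t+1) - 1))))).card)
    (k : ℕ) (hk1 : m + 1 ≤ k) (hk2 : k ≤ N)
    (q : ℕ)
    (hq : q = ((Icc (m+1) N).filter (fun k' =>
        List.Lex (· < ·) (S.drop (k'-1)) (S.drop (k-1)) ∨
          S.drop (k'-1) = S.drop (k-1))).card)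
    (t : ℕ)
    (ht : t = ((Icc 1 m).filter
      (fun ℓ => List.Lex (· < ·) (S.drop (ℓ-1)) (S.drop (k-1)))).card) :
    t ≤ m ∧
    (∑ s ∈ Finset.range t, gap s) < q ∧
    (∀ t' ≤ m, (∑ s ∈ Finset.range t', gap s) < q → t' ≤ t) ∧
    ((Icc 1 N).filter (fun k' =>
        List.Lex (· < ·) (S.drop (k'-1)) (S.drop (k-1)) ∨
          S.drop (k'-1) = S.drop (k-1))).card = q + t := by
  classical
  set f : ℕ → List α := fun p => S.drop (p - 1)
  have hinj : ∀ a b, 1 ≤ a → a ≤ N → 1 ≤ b → b ≤ N → f a = f b → a = b := by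
    intro a b ha haN hb hbN h
    subst hN
    exact S.injOn_drop_sub_one ⟨ha, haN⟩ ⟨hb, hbN⟩ h
  have hg : ∀ i j, 1 ≤ i → i < j → j ≤ m → f (sa_int i) < f (sa_int j) := hsa_sorted
  have hne : ∀ a ∈ Icc (m + 1) N, ∀ j, 1 ≤ j → j ≤ m → f a ≠ f (sa_int j) := by
    intro a ha j hj hjm h
    have hmem := hsa_mem j (mem_Icc.2 ⟨hj, hjm⟩)
    rw [mem_Icc] at ha hmem
    have := hinj a (sa_int j) (by omega) ha.2 hmem.1 (by omega) h
    omega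
  have hsum : ∀ n ≤ m, ∑ s ∈ range n, gap s = #{a ∈ Icc (m + 1) N | 1 ≤ n ∧ f a < f (sa_int n)} := by
    intro n hn
    convert sum_card_gaps_eq_card_filter_lt (g := fun j => f (sa_int j)) hg _ f hne gap
      (fun s hs => ?_) n hn
    rw [hgap s hs]
    congr!
  have hq' : q = #{a ∈ Icc (m + 1) N | f a ≤ f k} := by
    rw [hq]
    congr! 2 with a
    exact (le_iff_lt_or_eq (a := f a) (b := f k)).symm
  have ht' : t = #{ℓ ∈ Icc 1 m | f ℓ < f k} := by
    rw [ht]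
    congr!
  have htj : t = #{j ∈ Icc 1 m | f (sa_int j) < f k} := by
    rw [ht']
    symm
    refine card_bij (fun j _ => sa_int j) ?_ ?_ ?_
    · intro j hj
      rw [mem_filter] at hj ⊢
      exact ⟨hsa_mem j hj.1, hj.2⟩
    · intro i hi j hj h
      exact hsa_inj i (mem_filter.1 hi).1 j (mem_filter.1 hj).1 h
    · intro ℓ hℓ
      rw [mem_filter] at hℓ
      obtain ⟨j, hj, rfl⟩ := hsa_surj ℓ hℓ.1
      exact ⟨j, mem_filter.2 ⟨hj, hℓ.2⟩, rfl⟩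
  have hlt_iff : ∀ j, 1 ≤ j → j ≤ m → (f (sa_int j) < f k ↔ j ≤ t) := by
    intro j hj hjm
    rw [htj]
    convert lt_iff_le_card_filter_lt (g := fun j => f (sa_int j)) hg (f k) hj hjm
  have hkA : k ∈ Icc (m + 1) N := mem_Icc.2 ⟨hk1, hk2⟩
  have htm : t ≤ m := by
    rw [ht']
    simpa using card_filter_le (Icc 1 m) (fun ℓ => f ℓ < f k)
  refine ⟨htm, ?_, ?_, ?_⟩
  · rw [hsum t htm, hq']
    refine card_lt_card (Finset.ssubset_iff_subset_ne.2 ⟨?_, fun h => ?_⟩)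
    · intro a ha
      rw [mem_filter] at ha ⊢
      exact ⟨ha.1, (ha.2.2.trans ((hlt_iff t ha.2.1 htm).2 le_rfl)).le⟩
    · have hk : k ∈ ({a ∈ Icc (m + 1) N | f a ≤ f k} : Finset ℕ) := mem_filter.2 ⟨hkA, le_rfl⟩
      rw [← h, mem_filter] at hk
      exact lt_asymm hk.2.2 ((hlt_iff t hk.2.1 htm).2 le_rfl)
  · intro n hn hlt
    by_contra hnt
    have hn1 : 1 ≤ n := by omega
    have hle : f k ≤ f (sa_int n) := not_lt.1 fun h => hnt ((hlt_iff n hn1 hn).1 h)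
    have hlt' : f k < f (sa_int n) := lt_of_le_of_ne hle (hne k hkA n hn1 hn)
    rw [hsum n hn, hq'] at hlt
    refine absurd (card_le_card fun a ha => ?_) (not_le.2 hlt)
    rw [mem_filter] at ha ⊢
    exact ⟨ha.1, hn1, ha.2.trans_lt hlt'⟩
  · have hall : #{a ∈ Icc 1 N | f a ≤ f k} = q + t := by
      rw [hq', ht', ← card_union_of_disjoint]
      · congr 1
        ext a
        simp only [mem_union, mem_filter, mem_Icc]
        constructor
        · rintro ⟨⟨h1, h2⟩, h3⟩
          by_cases ham : a ≤ m
          · refine Or.inr ⟨⟨h1, ham⟩, lt_of_le_of_ne h3 fun h => ?_⟩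
            have := hinj a k h1 h2 (by omega) hk2 h
            omega
          · exact Or.inl ⟨⟨by omega, h2⟩, h3⟩
        · rintro (⟨⟨h1, h2⟩, h3⟩ | ⟨⟨h1, h2⟩, h3⟩)
          · exact ⟨⟨by omega, h2⟩, h3⟩
          · exact ⟨⟨h1, by omega⟩, h3.le⟩
      · rw [disjoint_left]
        intro a ha hb
        simp only [mem_filter, mem_Icc] at ha hb
        omega
    rw [← hall]
    congr! 2 with a
    exact (le_iff_lt_or_eq (a := f a) (b := f k)).symm
end

section
/- Let S be a string of length N and let m be such that 2m ≤ N, and let 1 ≤ i < j ≤ m. Then: (a) if the equal-length strings S[i..m] and S[j..j+m−i] are different, then S[i..N] ≺ S[j..N] if and only if S[i..m] ≺ S[j..j+m−i]; (b) if S[i..m] = S[j..j+m−i], then S[i..N] ≺ S[j..N] if and only if S[m+1..N] ≺ S[j+m−i+1..N]. -/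
namespace List

variable {α : Type*} {r : α → α → Prop}

theorem lex_append_append_iff_of_length_eq [Std.Irrefl r] :
    ∀ {A B : List α} (X Y : List α), A.length = B.length → A ≠ B →
      (Lex r (A ++ X) (B ++ Y) ↔ Lex r A B)
  | [], [], _, _, _, h => absurd rfl h
  | [], _ :: _, _, _, hl, _ => by simp at hl
  | _ :: _, [], _, _, hl, _ => by simp at hl
  | a :: A, b :: B, X, Y, hl, h => by
    by_cases hab : a = b
    · subst hab
      rw [cons_append, cons_append, lex_cons_iff, lex_cons_iff]
      exact lex_append_append_iff_of_length_eq X Y (by simpa using hl) (by simpa using h)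
    · simp [cons_lex_cons_iff, hab]

theorem lex_append_left_iff [Std.Irrefl r] (A X Y : List α) :
    Lex r (A ++ X) (A ++ Y) ↔ Lex r X Y := by
  induction A with
  | nil => rfl
  | cons a A ih => rw [cons_append, cons_append, lex_cons_iff, ih]

end List

/-- Let `S` be a string of length `N` over a linearly ordered alphabet, `2m ≤ N`, and
`1 ≤ i < j ≤ m`.  Here `S[a..b]` denotes `(S.drop (a-1)).take (b-a+1)` (1-based), and
`≺` is strict lexicographic order.
(a) If the equal-length strings `S[i..m]` and `S[j..j+m-i]` are different, then
`S[i..N] ≺ S[j..N] ↔ S[i..m] ≺ S[j..j+m-i]`.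
(b) If `S[i..m] = S[j..j+m-i]`, then `S[i..N] ≺ S[j..N] ↔ S[m+1..N] ≺ S[j+m-i+1..N]`. -/
theorem stmt4 {α : Type*} [LinearOrder α]
    (S : List α) (N m : ℕ) (hN : S.length = N) (hm : 2 * m ≤ N)
    (i j : ℕ) (hi : 1 ≤ i) (hij : i < j) (hj : j ≤ m) :
    (((S.drop (i-1)).take (m-i+1) ≠ (S.drop (j-1)).take (m-i+1)) →
      (List.Lex (· < ·) (S.drop (i-1)) (S.drop (j-1)) ↔
        List.Lex (· < ·) ((S.drop (i-1)).take (m-i+1)) ((S.drop (j-1)).take (m-i+1)))) ∧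
    (((S.drop (i-1)).take (m-i+1) = (S.drop (j-1)).take (m-i+1)) →
      (List.Lex (· < ·) (S.drop (i-1)) (S.drop (j-1)) ↔
        List.Lex (· < ·) (S.drop m) (S.drop (j+m-i)))) := by
  have hX := List.take_append_drop (m - i + 1) (S.drop (i - 1))
  have hY := List.take_append_drop (m - i + 1) (S.drop (j - 1))
  rw [List.drop_drop] at hX hY
  rw [show i - 1 + (m - i + 1) = m by omega] at hX
  rw [show j - 1 + (m - i + 1) = j + m - i by omega] at hY
  constructor
  · intro h
    conv_lhs => rw [← hX, ← hY]
    refine List.lex_append_append_iff_of_length_eq _ _ ?_ h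
    simp only [List.length_take, List.length_drop]
    omega
  · intro h
    conv_lhs => rw [← hX, ← hY, h]
    exact List.lex_append_left_iff _ _ _
end

section
/- The permutation Ψ is a single n-cycle: for every i ∈ [1,n], the orbit {Ψ^t(i) : 0 ≤ t < n} equals the whole set [1,n] (equivalently, Ψ has order n and acts transitively on [1,n]). -/
open Finset

/-- If `sa` conjugates `Ψ` to the cyclic shift of `[1,n]`, then it conjugates `Ψ^t` to the
shift by `t`. -/
theorem iterate_mem_and_shift {n : ℕ} {sa Ψ : ℕ → ℕ}
    (hsa_mem : ∀ i ∈ Icc 1 n, sa i ∈ Icc 1 n)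
    (hΨ_mem : ∀ i ∈ Icc 1 n, Ψ i ∈ Icc 1 n)
    (hΨ : ∀ i ∈ Icc 1 n, sa (Ψ i) = if sa i < n then sa i + 1 else 1)
    {i : ℕ} (hi : i ∈ Icc 1 n) (t : ℕ) (ht : t < n) :
    Ψ^[t] i ∈ Icc 1 n ∧
      sa (Ψ^[t] i) = if sa i + t ≤ n then sa i + t else sa i + t - n := by
  induction t with
  | zero =>
    have h := mem_Icc.mp (hsa_mem i hi)
    simp [hi, h.2]
  | succ t ih =>
    obtain ⟨hmem, hsa⟩ := ih (by omega)
    have h := mem_Icc.mp (hsa_mem i hi)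
    rw [Function.iterate_succ_apply']
    refine ⟨hΨ_mem _ hmem, ?_⟩
    rw [hΨ _ hmem, hsa]
    split_ifs <;> omega

/-- Let `T` be a string of length `n` over a linearly ordered alphabet whose last character
occurs nowhere else and is strictly smaller than every other character.  Let `sa` be the
suffix array of `T` (the permutation of `[1,n]` listing the suffixes in increasing
lexicographic order) and let `Ψ` be the permutation of `[1,n]` with
`sa[Ψ(i)] = sa[i]+1` if `sa[i] < n` and `sa[Ψ(i)] = 1` if `sa[i] = n`.
Then `Ψ` is a single `n`-cycle: for every `i ∈ [1,n]`, the orbit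
`{Ψ^t(i) : 0 ≤ t < n}` equals the whole set `[1,n]`.
(1-based positions `p` correspond to 0-based indices `p-1`.) -/
theorem stmt7 {α : Type*} [LinearOrder α] [Inhabited α]
    (T : List α) (n : ℕ) (hn : T.length = n)
    (hlast : ∀ k, 1 ≤ k → k < n → T[n-1]! < T[k-1]!)
    (sa : ℕ → ℕ)
    (hsa_mem : ∀ i ∈ Icc 1 n, sa i ∈ Icc 1 n)
    (hsa_inj : ∀ i ∈ Icc 1 n, ∀ j ∈ Icc 1 n, sa i = sa j → i = j)
    (hsa_surj : ∀ p ∈ Icc 1 n, ∃ i ∈ Icc 1 n, sa i = p)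
    (hsa_sorted : ∀ i, 1 ≤ i → i < n →
      List.Lex (· < ·) (T.drop (sa i - 1)) (T.drop (sa (i+1) - 1)))
    (Ψ : ℕ → ℕ)
    (hΨ_mem : ∀ i ∈ Icc 1 n, Ψ i ∈ Icc 1 n)
    (hΨ : ∀ i ∈ Icc 1 n, sa (Ψ i) = if sa i < n then sa i + 1 else 1) :
    ∀ i ∈ Icc 1 n, (Finset.range n).image (fun t => Ψ^[t] i) = Icc 1 n := by
  intro i hi
  have key := iterate_mem_and_shift hsa_mem hΨ_mem hΨ hi
  have hi' := mem_Icc.mp (hsa_mem i hi)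
  ext j
  simp only [mem_image, mem_range]
  constructor
  · rintro ⟨t, ht, rfl⟩
    exact (key t ht).1
  · intro hj
    have hj' := mem_Icc.mp (hsa_mem j hj)
    obtain ⟨t, ht, hshift⟩ : ∃ t < n,
        (if sa i + t ≤ n then sa i + t else sa i + t - n) = sa j := by
      rcases le_or_gt (sa i) (sa j) with h | h
      · exact ⟨sa j - sa i, by omega, by split_ifs <;> omega⟩
      · exact ⟨sa j + n - sa i, by omega, by split_ifs <;> omega⟩
    obtain ⟨hmem, hsa⟩ := key t ht
    exact ⟨t, ht, hsa_inj _ hmem _ hj (hsa.trans hshift)⟩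
end

section
/- For every 1 ≤ i ≤ n, T[i] = bwt[Ψ^i(pos[1])], where Ψ^i denotes the i-fold iterate of Ψ and pos[1] is the lexicographic rank of the whole string T among its suffixes. In particular, T is uniquely determined by bwt, Ψ, and pos[1]. -/
open Finset

/-- Let `T` be a string of length `n` over a linearly ordered alphabet whose last character
occurs nowhere else and is strictly smaller than every other character; let `sa` be its
suffix array, `pos = sa⁻¹`, `bwt` its Burrows–Wheeler transform (`bwt[i] = T[sa[i]-1]`
if `sa[i] > 1`, `bwt[i] = T[n]` if `sa[i] = 1`), and `Ψ` the permutation of `[1,n]`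
with `sa[Ψ(i)] = sa[i]+1` if `sa[i] < n` and `sa[Ψ(i)] = 1` if `sa[i] = n`.
Then for every `1 ≤ i ≤ n`, `T[i] = bwt[Ψ^i(pos[1])]`, where `Ψ^i` is the `i`-fold
iterate of `Ψ` (so `T` is uniquely determined by `bwt`, `Ψ` and `pos[1]`).
(1-based positions `p` correspond to 0-based indices `p-1`.) -/
theorem stmt9 {α : Type*} [LinearOrder α] [Inhabited α]
    (T : List α) (n : ℕ) (hn : T.length = n)
    (hlast : ∀ k, 1 ≤ k → k < n → T[n-1]! < T[k-1]!)
    (sa : ℕ → ℕ)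
    (hsa_mem : ∀ i ∈ Icc 1 n, sa i ∈ Icc 1 n)
    (hsa_inj : ∀ i ∈ Icc 1 n, ∀ j ∈ Icc 1 n, sa i = sa j → i = j)
    (hsa_surj : ∀ p ∈ Icc 1 n, ∃ i ∈ Icc 1 n, sa i = p)
    (hsa_sorted : ∀ i, 1 ≤ i → i < n →
      List.Lex (· < ·) (T.drop (sa i - 1)) (T.drop (sa (i+1) - 1)))
    (pos : ℕ → ℕ)
    (hpos_mem : ∀ p ∈ Icc 1 n, pos p ∈ Icc 1 n)
    (hpos : ∀ p ∈ Icc 1 n, sa (pos p) = p)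
    (bwt : ℕ → α)
    (hbwt : ∀ i ∈ Icc 1 n, bwt i = if 1 < sa i then T[sa i - 2]! else T[n-1]!)
    (Ψ : ℕ → ℕ)
    (hΨ_mem : ∀ i ∈ Icc 1 n, Ψ i ∈ Icc 1 n)
    (hΨ : ∀ i ∈ Icc 1 n, sa (Ψ i) = if sa i < n then sa i + 1 else 1) :
    ∀ i, 1 ≤ i → i ≤ n → T[i-1]! = bwt (Ψ^[i] (pos 1)) := by
  have iterate_lt : ∀ k, k < n → Ψ^[k] (pos 1) ∈ Icc 1 n ∧ sa (Ψ^[k] (pos 1)) = k + 1 := by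
    intro k
    induction k with
    | zero =>
      intro hk
      have h1 : 1 ∈ Icc 1 n := mem_Icc.2 ⟨le_rfl, hk⟩
      exact ⟨hpos_mem 1 h1, hpos 1 h1⟩
    | succ k ih =>
      intro hk
      obtain ⟨hmem, hsa⟩ := ih (by omega)
      rw [Function.iterate_succ_apply']
      exact ⟨hΨ_mem _ hmem, by rw [hΨ _ hmem, hsa, if_pos hk]⟩
  intro i hi hin
  obtain ⟨k, rfl⟩ : ∃ k, i = k + 1 := ⟨i - 1, by omega⟩
  obtain ⟨hmem, hsa⟩ := iterate_lt k hin
  rw [Function.iterate_succ_apply', hbwt _ (hΨ_mem _ hmem), hΨ _ hmem, hsa]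
  rcases hin.lt_or_eq with h | rfl
  · simp [h]
  · simp
end

section
/- Let W be a string of length r·L that is the concatenation of r blocks, each of length L ≥ 1 and each consisting of a single repeated character. Then every contiguous substring of W of length ℓ ≥ 1 can be written as a concatenation of at most ⌈ℓ/L⌉ + 1 strings, each consisting of a single repeated character. -/
/-- `w` is the concatenation of at most `n` constant strings. -/
def IsConcatOfConstant {α : Type*} (n : ℕ) (w : List α) : Prop :=
  ∃ parts : List (List α), parts.length ≤ n ∧ parts.flatten = w ∧
    ∀ p ∈ parts, ∀ x ∈ p, ∀ y ∈ p, x = y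

namespace IsConcatOfConstant

variable {α : Type*}

theorem nil (n : ℕ) : IsConcatOfConstant n ([] : List α) :=
  ⟨[], by simp, by simp, by simp⟩

theorem mono {m n : ℕ} {w : List α} (h : IsConcatOfConstant m w) (hmn : m ≤ n) :
    IsConcatOfConstant n w := by
  obtain ⟨parts, hlen, hflat, hconst⟩ := h
  exact ⟨parts, hlen.trans hmn, hflat, hconst⟩

theorem append {n : ℕ} {u w : List α} (hu : ∀ x ∈ u, ∀ y ∈ u, x = y)
    (hw : IsConcatOfConstant n w) : IsConcatOfConstant (n + 1) (u ++ w) := by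
  obtain ⟨parts, hlen, rfl, hconst⟩ := hw
  exact ⟨u :: parts, by simpa using hlen, by simp, List.forall_mem_cons.2 ⟨hu, hconst⟩⟩

/-- A prefix of length `ℓ` of a concatenation of constant blocks of length `L` is the
concatenation of at most `⌈ℓ / L⌉` constant strings. -/
theorem take_flatten {L : ℕ} (hL : 1 ≤ L) (blocks : List (List α))
    (hblocks : ∀ b ∈ blocks, b.length = L ∧ ∀ x ∈ b, ∀ y ∈ b, x = y) (ℓ : ℕ) :
    IsConcatOfConstant ((ℓ + L - 1) / L) (blocks.flatten.take ℓ) := by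
  induction blocks generalizing ℓ with
  | nil => simpa using nil _
  | cons b bs ih =>
    obtain ⟨⟨hb, hconst⟩, hbs⟩ := List.forall_mem_cons.1 hblocks
    rcases Nat.eq_zero_or_pos ℓ with rfl | hℓ
    · simpa using nil _
    · rw [List.flatten_cons, List.take_append, hb]
      refine (append (fun x hx y hy => hconst x (List.mem_of_mem_take hx) y
        (List.mem_of_mem_take hy)) (ih hbs (ℓ - L))).mono ?_
      rw [show ℓ + L - 1 = ℓ - 1 + L by omega, Nat.add_div_right _ hL, Nat.succ_le_succ_iff]
      rcases le_total ℓ L with h | h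
      · rw [Nat.div_eq_of_lt (by omega)]
        exact Nat.zero_le _
      · exact Nat.div_le_div_right (by omega)

/-- A substring of length `ℓ` of a concatenation of constant blocks of length `L` is the
concatenation of at most `⌈ℓ / L⌉ + 1` constant strings. -/
theorem take_drop_flatten {L : ℕ} (hL : 1 ≤ L) (blocks : List (List α))
    (hblocks : ∀ b ∈ blocks, b.length = L ∧ ∀ x ∈ b, ∀ y ∈ b, x = y) (a ℓ : ℕ) :
    IsConcatOfConstant ((ℓ + L - 1) / L + 1) ((blocks.flatten.drop a).take ℓ) := by
  induction blocks generalizing a with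
  | nil => simpa using nil _
  | cons b bs ih =>
    obtain ⟨⟨hb, hconst⟩, hbs⟩ := List.forall_mem_cons.1 hblocks
    rw [List.flatten_cons, List.drop_append, hb]
    rcases le_total L a with h | h
    · rw [List.drop_eq_nil_of_le (hb.trans_le h), List.nil_append]
      exact ih hbs (a - L)
    · rw [Nat.sub_eq_zero_of_le h, List.drop_zero, List.take_append]
      refine (append (fun x hx y hy => hconst x (List.mem_of_mem_drop (List.mem_of_mem_take hx)) y
        (List.mem_of_mem_drop (List.mem_of_mem_take hy))) (take_flatten hL bs hbs _)).mono ?_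
      exact Nat.succ_le_succ (Nat.div_le_div_right (by omega))

end IsConcatOfConstant

/-- Let `W` be a string of length `r·L` that is the concatenation of `r` blocks, each of
length `L ≥ 1` and each consisting of a single repeated character.  Then every
contiguous substring of `W` of length `ℓ ≥ 1` can be written as the concatenation of at
most `⌈ℓ/L⌉ + 1` strings, each consisting of a single repeated character.
(The substring starting at 1-based position `a+1` of length `ℓ` is
`(W.drop a).take ℓ`, and `⌈ℓ/L⌉ = (ℓ + L - 1) / L` in natural-number arithmetic.) -/
theorem stmt10 {α : Type*} (W : List α) (r L : ℕ) (hL : 1 ≤ L)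
    (blocks : List (List α))
    (hW : W = blocks.flatten)
    (hr : blocks.length = r)
    (hblocks : ∀ b ∈ blocks, b.length = L ∧ ∀ x ∈ b, ∀ y ∈ b, x = y)
    (a ℓ : ℕ) (hℓ : 1 ≤ ℓ) (ha : a + ℓ ≤ r * L) :
    ∃ parts : List (List α),
      parts.length ≤ (ℓ + L - 1) / L + 1 ∧
      parts.flatten = (W.drop a).take ℓ ∧
      ∀ p ∈ parts, ∀ x ∈ p, ∀ y ∈ p, x = y := by
  subst hW
  exact IsConcatOfConstant.take_drop_flatten hL blocks hblocks a ℓ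
end
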